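/- Let e = R_{e₁,e₋₂} + R_{e₂,e₀} and h = 4·R_{e₁,e₋₁} + 2·R_{e₂,e₋₂}, both elements of so(V, β). Then there exists f ∈ so(V, β) such that ⁅h, e⁆ = 2·e, ⁅h, f⁆ = −2·f, and ⁅e, f⁆ = h (so {e, h, f} is an sl(2)-triple in so(V, β)). -/

import Mathlib

noncomputable section

/-- `V = ℂ⁷` with ordered basis `(e₁, e₂, e₃, e₀, e₋₃, e₋₂, e₋₁)`. -/
abbrev V7 : Type := Fin 7 → ℂ

/-- The Gram matrix of the symmetric bilinear form `β` in the ordered basis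
`(e₁, e₂, e₃, e₀, e₋₃, e₋₂, e₋₁)`:  `β(eᵢ, e₋ᵢ) = β(e₋ᵢ, eᵢ) = 1`, `β(e₀,e₀) = 2`,
all other pairs `0`. -/
def Bmat : Matrix (Fin 7) (Fin 7) ℂ :=
  Matrix.of fun i j =>
    if (i : ℕ) + (j : ℕ) = 6 then (if (i : ℕ) = 3 then 2 else 1) else 0

/-- The symmetric bilinear form `β` on `V`. -/
def beta : V7 →ₗ[ℂ] V7 →ₗ[ℂ] ℂ := Matrix.toBilin' Bmat

/-- `so(V, β) = {x ∈ End(V) : β(xu, w) + β(u, xw) = 0 for all u, w}`. -/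
def so7 : Set (Module.End ℂ V7) :=
  {x | ∀ u w : V7, beta (x u) w + beta u (x w) = 0}

/-- `R_{u,w}(v) = β(w,v) • u − β(u,v) • w`. -/
def Rm (u w : V7) : Module.End ℂ V7 :=
  (beta w).smulRight u - (beta u).smulRight w

def e1 : V7 := Pi.single 0 1
def e2 : V7 := Pi.single 1 1
def e3 : V7 := Pi.single 2 1
def e0 : V7 := Pi.single 3 1
def em3 : V7 := Pi.single 4 1
def em2 : V7 := Pi.single 5 1
def em1 : V7 := Pi.single 6 1

/-- The nilpotent element. -/
def eNil : Module.End ℂ V7 := Rm e1 em2 + Rm e2 e0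

/-- The semisimple element. -/
def hSem : Module.End ℂ V7 := (4:ℂ) • Rm e1 em1 + (2:ℂ) • Rm e2 em2

theorem beta_apply (u v : V7) :
    beta u v = u 0 * v 6 + u 1 * v 5 + u 2 * v 4 + 2 * (u 3 * v 3) + u 4 * v 2 + u 5 * v 1
      + u 6 * v 0 := by
  simp [beta, Bmat, Matrix.toBilin'_apply, Fin.sum_univ_seven]
  ring

theorem beta_comm (u v : V7) : beta u v = beta v u := by
  simp only [beta_apply]
  ring

theorem Rm_apply (u w v : V7) : Rm u w v = beta w v • u - beta u v • w := rfl

theorem Rm_mem_so7 (u w : V7) : Rm u w ∈ so7 := by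
  intro a b
  simp only [Rm_apply, map_sub, map_smul, LinearMap.sub_apply, LinearMap.smul_apply, smul_eq_mul,
    beta_comm a]
  ring

theorem so7_smul_add_smul {x y : Module.End ℂ V7} (hx : x ∈ so7) (hy : y ∈ so7) (s t : ℂ) :
    s • x + t • y ∈ so7 := by
  intro u w
  simp only [LinearMap.add_apply, LinearMap.smul_apply, map_add, map_smul]
  linear_combination s * hx u w + t * hy u w

theorem statement8 :
    ∃ f ∈ so7, ⁅hSem, eNil⁆ = (2 : ℂ) • eNil ∧ ⁅hSem, f⁆ = (-2 : ℂ) • f ∧ ⁅eNil, f⁆ = hSem := by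
  refine ⟨(4 : ℂ) • Rm e2 em1 + (3 : ℂ) • Rm e0 em2,
    so7_smul_add_smul (Rm_mem_so7 _ _) (Rm_mem_so7 _ _) _ _, ?_, ?_, ?_⟩
  all_goals
    refine LinearMap.ext fun v => ?_
    simp only [hSem, eNil, Ring.lie_def, Module.End.mul_apply, LinearMap.sub_apply,
      LinearMap.add_apply, LinearMap.smul_apply, Rm_apply, map_sub, map_add, map_smul]
    simp [beta_apply, e1, e2, e0, em1, em2]
    module
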